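/- arXiv:2205.08796 — 3 statements merged into one kernel-verified Lean document; each statement's English description precedes it below -/
import Mathlib

section
/- Let A be an n×n real Metzler matrix (all off-diagonal entries of A are nonnegative). Then A is Hurwitz stable (every eigenvalue λ of A satisfies Re λ < 0) if and only if there exists a vector ζ ∈ ℝ^n with all components strictly positive such that every component of Aζ is strictly negative. -/
open Matrix in
/-- If `A` is Metzler and `(t I - A) x = 1` with `x ≥ 0`, then `x ≫ 0`. -/
theorem Matrix.pos_of_metzler_of_nonneg {ι : Type*} [Fintype ι] [DecidableEq ι]
    {A : Matrix ι ι ℝ} (hA : ∀ i j, i ≠ j → 0 ≤ A i j) {t : ℝ} {x : ι → ℝ}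
    (hx : ∀ i, t * x i - (A *ᵥ x) i = 1) (h0 : ∀ i, 0 ≤ x i) (i : ι) : 0 < x i := by
  refine lt_of_le_of_ne (h0 i) fun hi => ?_
  have hsum : 0 ≤ (A *ᵥ x) i := Finset.sum_nonneg fun j _ => by
    rcases eq_or_ne i j with rfl | hij
    · simp [← hi]
    · exact mul_nonneg (hA i j hij) (h0 j)
  have := hx i
  rw [← hi] at this
  linarith

open Matrix in
/-- If `A` is Metzler, `t` exceeds every row sum of `A` and `(t I - A) x = 1`, then `x ≥ 0`. -/
theorem Matrix.nonneg_of_metzler_of_row_sum_lt {ι : Type*} [Fintype ι]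
    {A : Matrix ι ι ℝ} (hA : ∀ i j, i ≠ j → 0 ≤ A i j) {t : ℝ} {x : ι → ℝ}
    (hx : ∀ i, t * x i - (A *ᵥ x) i = 1) (ht : ∀ i, ∑ j, A i j < t) (i : ι) : 0 ≤ x i := by
  have : Nonempty ι := ⟨i⟩
  obtain ⟨k, hk⟩ := Finite.exists_min x
  refine le_trans ?_ (hk i)
  have hsum : (∑ j, A k j) * x k ≤ (A *ᵥ x) k := by
    rw [Finset.sum_mul]
    refine Finset.sum_le_sum fun j _ => ?_
    rcases eq_or_ne k j with rfl | hkj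
    · rfl
    · exact mul_le_mul_of_nonneg_left (hk j) (hA k j hkj)
  by_contra! hneg
  nlinarith [hx k, ht k]

open Matrix in
/-- If `A` is Metzler and `t I - A` is nonsingular for all real `t ≥ 0`, then `A ζ ≪ 0` for
some `ζ ≫ 0`. -/
theorem Matrix.exists_pos_mulVec_neg_of_metzler {ι : Type*} [Fintype ι] [DecidableEq ι]
    {A : Matrix ι ι ℝ} (hA : ∀ i j, i ≠ j → 0 ≤ A i j)
    (hdet : ∀ t : ℝ, 0 ≤ t → (t • (1 : Matrix ι ι ℝ) - A).det ≠ 0) :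
    ∃ ζ : ι → ℝ, (∀ i, 0 < ζ i) ∧ ∀ i, (A *ᵥ ζ) i < 0 := by
  let M : Set.Ici (0 : ℝ) → Matrix ι ι ℝ := fun t => (t : ℝ) • (1 : Matrix ι ι ℝ) - A
  let x : Set.Ici (0 : ℝ) → ι → ℝ := fun t => (M t).det⁻¹ • ((M t).adjugate *ᵥ 1)
  have hM : Continuous M := by fun_prop
  have hxc : Continuous x :=
    (hM.matrix_det.inv₀ fun t => hdet t t.2).smul
      (hM.matrix_adjugate.matrix_mulVec continuous_const)
  have hx : ∀ (t : Set.Ici (0 : ℝ)) i, (t : ℝ) * x t i - (A *ᵥ x t) i = 1 := by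
    intro t i
    have h : M t *ᵥ x t = 1 := by
      simp only [x, mulVec_smul, mulVec_mulVec, mul_adjugate, smul_mulVec, one_mulVec]
      rw [smul_smul, inv_mul_cancel₀ (hdet t t.2), one_smul]
    simpa [M, sub_mulVec, smul_mulVec] using congrFun h i
  have hS : {t | ∀ i, 0 < x t i} = {t | ∀ i, 0 ≤ x t i} :=
    Set.Subset.antisymm (fun t h i => (h i).le)
      fun t h i => pos_of_metzler_of_nonneg hA (hx t) h i
  have hxi : ∀ i, Continuous fun t => x t i := fun i => (continuous_apply i).comp hxc
  have hopen : IsOpen {t | ∀ i, 0 < x t i} := by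
    simp only [Set.ofPred_forall]
    exact isOpen_iInter_of_finite fun i => isOpen_lt continuous_const (hxi i)
  have hclosed : IsClosed {t | ∀ i, 0 < x t i} := by
    rw [hS]
    simp only [Set.ofPred_forall]
    exact isClosed_iInter fun i => isClosed_le continuous_const (hxi i)
  have hne : {t | ∀ i, 0 < x t i}.Nonempty := by
    obtain ⟨C, hC⟩ := (Set.finite_range fun i => ∑ j, A i j).bddAbove
    refine ⟨⟨max C 0 + 1, by simp only [Set.mem_Ici]; positivity⟩, ?_⟩
    rw [hS]
    refine fun i => nonneg_of_metzler_of_row_sum_lt hA (hx _) (fun k => ?_) i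
    have := hC ⟨k, rfl⟩
    exact (this.trans (le_max_left C 0)).trans_lt (lt_add_one _)
  have : PreconnectedSpace (Set.Ici (0 : ℝ)) := Subtype.preconnectedSpace isPreconnected_Ici
  have huniv := IsClopen.eq_univ ⟨hclosed, hopen⟩ hne
  let z : Set.Ici (0 : ℝ) := ⟨0, Set.self_mem_Ici⟩
  have hz : z ∈ {t | ∀ i, 0 < x t i} := huniv ▸ Set.mem_univ z
  refine ⟨x z, hz, fun i => ?_⟩
  have : 0 * x z i - (A *ᵥ x z) i = 1 := hx z i
  linarith

open Matrix in
/-- If `A` is Metzler and `A ζ ≪ 0` for some `ζ ≫ 0`, then every complex eigenvalue of `A` has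
negative real part. -/
theorem Matrix.re_neg_of_metzler_of_mulVec_neg {ι : Type*} [Fintype ι] [DecidableEq ι]
    {A : Matrix ι ι ℝ} (hA : ∀ i j, i ≠ j → 0 ≤ A i j) {ζ : ι → ℝ} (hζ : ∀ i, 0 < ζ i)
    (hAζ : ∀ i, (A *ᵥ ζ) i < 0) {μ : ℂ}
    (hμ : (μ • (1 : Matrix ι ι ℂ) - A.map Complex.ofReal).det = 0) : μ.re < 0 := by
  obtain ⟨v, hv, hvμ⟩ := exists_mulVec_eq_zero_iff.mpr hμ
  obtain ⟨k, hk⟩ := Function.ne_iff.mp hv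
  have : Nonempty ι := ⟨k⟩
  obtain ⟨i, hi⟩ := Finite.exists_max fun j => ‖v j‖ / ζ j
  set c := ‖v i‖ / ζ i with hc
  have hcpos : 0 < c := (div_pos (norm_pos_iff.mpr hk) (hζ k)).trans_le (hi k)
  have hvi : ‖v i‖ = c * ζ i := by rw [hc, div_mul_cancel₀ _ (hζ i).ne']
  have hvj : ∀ j, ‖v j‖ ≤ c * ζ j := fun j => (div_le_iff₀ (hζ j)).mp (hi j)
  have heig : (μ - A i i) * v i = ∑ j ∈ Finset.univ.erase i, (A i j : ℂ) * v j := by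
    have h := congrFun hvμ i
    rw [sub_mulVec, smul_mulVec, one_mulVec] at h
    simp only [Pi.sub_apply, Pi.smul_apply, smul_eq_mul, Pi.zero_apply, mulVec, dotProduct,
      map_apply] at h
    rw [← Finset.add_sum_erase _ _ (Finset.mem_univ i)] at h
    linear_combination h
  have hrow : A i i * ζ i + ∑ j ∈ Finset.univ.erase i, A i j * ζ j < 0 := by
    rw [Finset.add_sum_erase _ (fun j => A i j * ζ j) (Finset.mem_univ i)]
    exact hAζ i
  have hle : ‖μ - A i i‖ * ‖v i‖ ≤ c * ∑ j ∈ Finset.univ.erase i, A i j * ζ j := by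
    rw [← norm_mul, heig, Finset.mul_sum]
    refine norm_sum_le_of_le _ fun j hj => ?_
    have hij := hA i j (Finset.ne_of_mem_erase hj).symm
    rw [norm_mul, Complex.norm_of_nonneg hij]
    exact (mul_le_mul_of_nonneg_left (hvj j) hij).trans_eq (by ring)
  have hlt : ‖μ - A i i‖ * (c * ζ i) < -A i i * (c * ζ i) := by
    rw [← hvi]
    refine hle.trans_lt ?_
    rw [hvi]
    nlinarith
  have hnorm := lt_of_mul_lt_mul_right hlt (mul_pos hcpos (hζ i)).le
  have hre := (Complex.re_le_norm (μ - A i i)).trans_lt hnorm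
  simp only [Complex.sub_re, Complex.ofReal_re] at hre
  linarith

/-- A real Metzler matrix `A` (off-diagonal entries nonnegative) is Hurwitz stable
(every root `μ` of `det (μ I - A) = 0` satisfies `Re μ < 0`) if and only if there is a
strictly positive vector `ζ` with `A ζ ≪ 0`. -/
theorem metzler_hurwitz_iff_exists_pos_vec (n : ℕ) (A : Matrix (Fin n) (Fin n) ℝ)
    (hMetzler : ∀ i j, i ≠ j → 0 ≤ A i j) :
    (∀ μ : ℂ, ((μ • (1 : Matrix (Fin n) (Fin n) ℂ)) - A.map Complex.ofReal).det = 0 → μ.re < 0)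
      ↔ ∃ ζ : Fin n → ℝ, (∀ i, 0 < ζ i) ∧ (∀ i, A.mulVec ζ i < 0) := by
  refine ⟨fun h => Matrix.exists_pos_mulVec_neg_of_metzler hMetzler fun t ht hdet => ?_,
    fun ⟨ζ, hζ, hAζ⟩ μ hμ => Matrix.re_neg_of_metzler_of_mulVec_neg hMetzler hζ hAζ hμ⟩
  refine (h t ?_).not_ge ht
  have hmap : (t : ℂ) • (1 : Matrix (Fin n) (Fin n) ℂ) - A.map Complex.ofReal
      = Complex.ofRealHom.mapMatrix (t • (1 : Matrix (Fin n) (Fin n) ℝ) - A) := by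
    ext i j
    simp [Matrix.one_apply, apply_ite Complex.ofReal]
  rw [hmap, ← RingHom.map_det, hdet, map_zero]
end

section
/- Consider the time-varying nondelay system ẋ(t) = A(t) f(x(t)) for t ≥ 0, where A(·) : [0,∞) → ℝ^{n×n} is a continuous matrix function and f is an admissible diagonal nonlinearity in the infinite sector K[δ,∞) (i.e. x f_i(x) ≥ δ_i x² for all x ≠ 0, with δ_i > 0). Let Â(t) be defined by â_ii(t) = a_ii(t) and â_ij(t) = |a_ij(t)| for i ≠ j. Assume there exists ξ ∈ ℝ^n with ξ ≫ 0 such that γ := max_{j=1,…,n} sup_{t≥0} Σ_{i=1}^n â_ij(t) ξ_i < 0. Let δ₀ = min_j δ_j and d₂ = max_i ξ_i. Then for every α ∈ (0, −γ δ₀ / d₂) there exists M > 0 such that for every admissible f ∈ K[δ,∞), every x₀ ∈ ℝ^n, and every differentiable x : [0,∞) → ℝ^n satisfying ẋ(t) = A(t) f(x(t)) with x(0) = x₀, one has ‖x(t)‖₁ ≤ M e^{−α t} ‖x₀‖₁ for all t ≥ 0. -/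
open scoped Matrix

/-- The absolute value of a function differentiable at `t` with derivative `g'` has right derivative
`SignType.sign (g t) * g'` if `g t ≠ 0`, and `|g'|` if `g t = 0`. -/
theorem hasDerivWithinAt_abs_comp_Ici {g : ℝ → ℝ} {g' t : ℝ} (hg : HasDerivAt g g' t) :
    HasDerivWithinAt (fun s => |g s|)
      (if g t = 0 then |g'| else (SignType.sign (g t) : ℝ) * g') (Set.Ici t) t := by
  split_ifs with h
  · rw [hasDerivWithinAt_iff_tendsto_slope, Set.Ici_sdiff_left]
    have h1 := (hasDerivWithinAt_iff_tendsto_slope.1 (hg.hasDerivWithinAt (s := Set.Ici t))).abs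
    rw [Set.Ici_sdiff_left] at h1
    refine h1.congr' ?_
    filter_upwards [self_mem_nhdsWithin] with z hz
    have hz' : 0 < z - t := sub_pos.2 hz
    simp [slope_def_field, h, abs_div, abs_of_pos hz']
  · exact ((hasDerivAt_abs h).comp t hg).hasDerivWithinAt

/-- A continuous function in the sector `[δ, ∞)` vanishes at the origin. -/
theorem sector_map_zero {φ : ℝ → ℝ} {δ : ℝ} (hδ : 0 < δ) (hφ : Continuous φ)
    (hs : ∀ y : ℝ, y ≠ 0 → δ * y ^ 2 ≤ y * φ y) : φ 0 = 0 := by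
  apply le_antisymm
  · refine le_of_tendsto (hφ.continuousWithinAt (s := Set.Iio 0) (x := 0)) ?_
    filter_upwards [self_mem_nhdsWithin] with y (hy : y < 0)
    have := hs y hy.ne
    by_contra! hc
    nlinarith [mul_pos hδ (pow_pos (neg_pos.2 hy) 2), mul_pos (neg_pos.2 hy) hc]
  · refine ge_of_tendsto (hφ.continuousWithinAt (s := Set.Ioi 0) (x := 0)) ?_
    filter_upwards [self_mem_nhdsWithin] with y (hy : 0 < y)
    have := hs y hy.ne'
    by_contra! hc
    nlinarith [mul_pos hδ (pow_pos hy 2), mul_pos hy (neg_pos.2 hc)]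

theorem sector_sign_mul_eq_abs {φ : ℝ → ℝ} {δ : ℝ} (hδ : 0 < δ)
    (hs : ∀ y : ℝ, y ≠ 0 → δ * y ^ 2 ≤ y * φ y) {y : ℝ} (hy : y ≠ 0) :
    (SignType.sign y : ℝ) * φ y = |φ y| := by
  have h := hs y hy
  have hpos : 0 < y * φ y := lt_of_lt_of_le (by positivity) h
  rcases pos_and_pos_or_neg_and_neg_of_mul_pos hpos with ⟨h1, h2⟩ | ⟨h1, h2⟩
  · simp [sign_pos h1, abs_of_pos h2]
  · simp [sign_neg h1, abs_of_neg h2]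

theorem sector_mul_abs_le {φ : ℝ → ℝ} {δ : ℝ}
    (hs : ∀ y : ℝ, y ≠ 0 → δ * y ^ 2 ≤ y * φ y) (y : ℝ) : δ * |y| ≤ |φ y| := by
  rcases eq_or_ne y 0 with rfl | hy
  · simp
  · have h : |y| * (δ * |y|) ≤ |y| * |φ y| := by
      calc |y| * (δ * |y|) = δ * y ^ 2 := by rw [← sq_abs y]; ring
        _ ≤ y * φ y := hs y hy
        _ ≤ |y| * |φ y| := by rw [← abs_mul]; exact le_abs_self _
    exact le_of_mul_le_mul_left h (abs_pos.2 hy)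

/-- Bound on the right derivative of `|x i|` along `ẋ = B f(x)` by the comparison matrix of `B`. -/
theorem right_deriv_abs_le {n : ℕ} (B : Matrix (Fin n) (Fin n) ℝ) (v w : Fin n → ℝ) (i : Fin n)
    (hzero : v i = 0 → w i = 0)
    (hsign : v i ≠ 0 → (SignType.sign (v i) : ℝ) * w i = |w i|) :
    (if v i = 0 then |(B *ᵥ w) i| else (SignType.sign (v i) : ℝ) * (B *ᵥ w) i) ≤
      ∑ j, (if i = j then B i i else |B i j|) * |w j| := by
  simp only [Matrix.mulVec, dotProduct]
  split_ifs with h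
  · refine (Finset.abs_sum_le_sum_abs _ _).trans (Finset.sum_le_sum fun j _ => ?_)
    split_ifs with hij
    · subst hij
      simp [hzero h]
    · rw [abs_mul]
  · rw [Finset.mul_sum]
    refine Finset.sum_le_sum fun j _ => ?_
    split_ifs with hij
    · subst hij
      rw [← hsign h]
      exact le_of_eq (by ring)
    · rw [← abs_mul]
      rcases lt_or_gt_of_ne h with h' | h'
      · simpa [sign_neg h'] using neg_le_abs (B i j * w j)
      · simpa [sign_pos h'] using le_abs_self (B i j * w j)

/-- Corollary 1: absolute exponential stability of the nondelay time-varying system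
`ẋ(t) = A(t) f(x(t))` with `f ∈ K[δ,∞)`, under the condition
`γ := max_j sup_{t ≥ 0} Σ_i â_ij(t) ξ_i < 0`, with decay rate any `α ∈ (0, -γ δ₀ / d₂)`,
where `δ₀ = min_j δ_j` and `d₂ = max_i ξ_i`. -/
theorem AES_nondelay_time_varying (n : ℕ)
    (A : ℝ → Matrix (Fin n) (Fin n) ℝ) (hA : Continuous A)
    (δ : Fin n → ℝ) (hδpos : ∀ i, 0 < δ i)
    (ξ : Fin n → ℝ) (hξ : ∀ i, 0 < ξ i)
    (γ : ℝ)
    (hγ : IsLUB {s : ℝ | ∃ j : Fin n, ∃ t : ℝ, 0 ≤ t ∧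
      s = ∑ i, (if i = j then A t i i else |A t i j|) * ξ i} γ)
    (hγneg : γ < 0)
    (δ₀ d₂ : ℝ) (hδ₀ : IsGLB (Set.range δ) δ₀) (hd₂ : IsLUB (Set.range ξ) d₂)
    (α : ℝ) (hα0 : 0 < α) (hαlt : α < -γ * δ₀ / d₂) :
    ∃ M : ℝ, 0 < M ∧ ∀ f : Fin n → ℝ → ℝ,
      (∀ i, Continuous (f i)) → (∀ i, LocallyLipschitz (f i)) →
      (∀ i, ∀ y : ℝ, y ≠ 0 → δ i * y ^ 2 ≤ y * f i y) →
      ∀ x₀ : Fin n → ℝ, ∀ x : ℝ → Fin n → ℝ,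
        (∀ t, 0 ≤ t → HasDerivAt x (A t *ᵥ (fun i => f i (x t i))) t) →
        x 0 = x₀ →
        ∀ t, 0 ≤ t → ∑ i, |x t i| ≤ M * Real.exp (-α * t) * ∑ i, |x₀ i| := by
  rcases Nat.eq_zero_or_pos n with rfl | hn
  · exact ⟨1, one_pos, fun f _ _ _ x₀ x _ _ t _ => by simp⟩
  have : Nonempty (Fin n) := ⟨⟨0, hn⟩⟩
  have hξd : ∀ i, ξ i ≤ d₂ := fun i => hd₂.1 ⟨i, rfl⟩
  have hδ₀le : ∀ i, δ₀ ≤ δ i := fun i => hδ₀.1 ⟨i, rfl⟩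
  have hd₂pos : 0 < d₂ := (hξ ⟨0, hn⟩).trans_le (hξd _)
  have hSpos : 0 < ∑ i, (ξ i)⁻¹ :=
    Finset.sum_pos (fun i _ => inv_pos.2 (hξ i)) Finset.univ_nonempty
  refine ⟨(∑ i, (ξ i)⁻¹) * d₂, mul_pos hSpos hd₂pos, ?_⟩
  intro f hf _ hs x₀ x hx hx0 t ht
  have hxi : ∀ s, 0 ≤ s → ∀ i,
      HasDerivAt (fun r => x r i) ((A s *ᵥ fun j => f j (x s j)) i) s :=
    fun s hs' i => hasDerivAt_pi.1 (hx s hs') i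
  set V : ℝ → ℝ := fun s => ∑ i, ξ i * |x s i| with hV
  set V' : ℝ → ℝ := fun s => ∑ i, ξ i * (if x s i = 0 then |(A s *ᵥ fun j => f j (x s j)) i| else
    (SignType.sign (x s i) : ℝ) * (A s *ᵥ fun j => f j (x s j)) i) with hV'
  have hVderiv : ∀ s, 0 ≤ s → HasDerivWithinAt V (V' s) (Set.Ici s) s := fun s hs' =>
    HasDerivWithinAt.fun_sum fun i _ =>
      (hasDerivWithinAt_abs_comp_Ici (hxi s hs' i)).const_mul (ξ i)
  have hVcont : ContinuousOn V (Set.Icc 0 t) := by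
    refine continuousOn_finsetSum _ fun i _ => continuousOn_const.mul ?_
    exact ContinuousOn.abs fun s hs' => (hxi s hs'.1 i).continuousAt.continuousWithinAt
  have hVnonneg : ∀ s, 0 ≤ V s := fun s =>
    Finset.sum_nonneg fun i _ => mul_nonneg (hξ i).le (abs_nonneg _)
  have hbound : ∀ s, 0 ≤ s → V' s ≤ -α * V s := by
    intro s hs'
    calc V' s ≤ ∑ i, ξ i * ∑ j, (if i = j then A s i i else |A s i j|) * |f j (x s j)| := by
          refine Finset.sum_le_sum fun i _ => mul_le_mul_of_nonneg_left ?_ (hξ i).le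
          refine right_deriv_abs_le (A s) (x s) (fun j => f j (x s j)) i (fun h => ?_)
            fun h => sector_sign_mul_eq_abs (hδpos i) (hs i) h
          simpa [h] using sector_map_zero (hδpos i) (hf i) (hs i)
      _ = ∑ j, (∑ i, (if i = j then A s i i else |A s i j|) * ξ i) * |f j (x s j)| := by
          simp only [Finset.mul_sum, Finset.sum_mul]
          rw [Finset.sum_comm]
          refine Finset.sum_congr rfl fun j _ => Finset.sum_congr rfl fun i _ => by ring
      _ ≤ ∑ j, -α * (ξ j * |x s j|) := by
          refine Finset.sum_le_sum fun j _ => ?_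
          have h1 : ∑ i, (if i = j then A s i i else |A s i j|) * ξ i ≤ γ := hγ.1 ⟨j, s, hs', rfl⟩
          have h2 : δ₀ * |x s j| ≤ |f j (x s j)| :=
            (mul_le_mul_of_nonneg_right (hδ₀le j) (abs_nonneg _)).trans (sector_mul_abs_le (hs j) _)
          have h3 : α * ξ j ≤ -γ * δ₀ :=
            (mul_le_mul_of_nonneg_left (hξd j) hα0.le).trans ((lt_div_iff₀ hd₂pos).1 hαlt).le
          calc _ ≤ γ * |f j (x s j)| := mul_le_mul_of_nonneg_right h1 (abs_nonneg _)
            _ ≤ γ * (δ₀ * |x s j|) := mul_le_mul_of_nonpos_left h2 hγneg.le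
            _ ≤ -α * (ξ j * |x s j|) := by
              nlinarith [mul_le_mul_of_nonneg_right h3 (abs_nonneg (x s j))]
      _ = -α * V s := by rw [hV, Finset.mul_sum]
  have hVexp : V t ≤ V 0 * Real.exp (-α * t) := by
    have := le_gronwallBound_of_liminf_deriv_right_le (f := V) (f' := V') (δ := V 0) (K := -α)
      (ε := 0) hVcont
      (fun s hs' r hr => by
        simpa [slope_def_field, div_eq_inv_mul] using (hVderiv s hs'.1).liminf_right_slope_le hr)
      le_rfl (fun s hs' => by simpa using hbound s hs'.1) t ⟨ht, le_rfl⟩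
    simpa [gronwallBound_ε0] using this
  have hV0 : V 0 ≤ d₂ * ∑ i, |x₀ i| := by
    rw [hV, Finset.mul_sum, ← hx0]
    exact Finset.sum_le_sum fun i _ => mul_le_mul_of_nonneg_right (hξd i) (abs_nonneg _)
  calc ∑ i, |x t i| ≤ ∑ i, (ξ i)⁻¹ * V t := by
        refine Finset.sum_le_sum fun i _ => ?_
        rw [← div_eq_inv_mul, le_div_iff₀' (hξ i)]
        exact Finset.single_le_sum (f := fun i => ξ i * |x t i|)
          (fun i _ => mul_nonneg (hξ i).le (abs_nonneg _)) (Finset.mem_univ i)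
    _ = (∑ i, (ξ i)⁻¹) * V t := by rw [Finset.sum_mul]
    _ ≤ (∑ i, (ξ i)⁻¹) * (d₂ * (∑ i, |x₀ i|) * Real.exp (-α * t)) := by
        gcongr
        exact hVexp.trans (mul_le_mul_of_nonneg_right hV0 (Real.exp_pos _).le)
    _ = _ := by ring
end

section
/- Consider the time-varying nonlinear difference system x(k+1) = A(k) f(x(k)) + B(k) f(x(k−h)) for k ∈ ℤ₊, where h ∈ ℤ₊, A(k), B(k) ∈ ℝ^{n×n} for each k, and f is a diagonal nonlinearity in the sector K(0,β] (i.e. 0 < x f_i(x) ≤ β_i x² for all x ≠ 0, with β_i > 0, and f_i(0) = 0). Assume there exist a vector ξ ∈ ℝ^n with ξ ≫ 0 and λ ∈ (0,1) such that (|A(k)| + λ^{−h} |B(k)|) D_β ξ ≤ λ ξ componentwise for all k ∈ ℤ₊, where D_β = diag(β_1,…,β_n) and |A(k)|, |B(k)| denote entrywise absolute values. Then there exists L > 0 such that for every f ∈ K(0,β], every initial function φ : {−h,…,0} → ℝ^n, and the corresponding solution x(k) (defined by the recursion with x(k) = φ(k) for k ∈ {−h,…,0}), one has ‖x(k)‖₁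 ≤ L λ^k max_{j∈{−h,…,0}} ‖φ(j)‖₁ for all k ∈ ℤ₊. In fact one may take L = (min_j ξ_j)^{−1} · Σ_j ξ_j. -/
open scoped Matrix

/-- A function in the sector `K(0,b]` is bounded in absolute value by `b * |y|`. -/
theorem abs_le_mul_abs_of_sector {g : ℝ → ℝ} {b : ℝ}
    (hg : ∀ y : ℝ, y ≠ 0 → 0 < y * g y ∧ y * g y ≤ b * y ^ 2) (hg0 : g 0 = 0) (y : ℝ) :
    |g y| ≤ b * |y| := by
  rcases eq_or_ne y 0 with rfl | hy
  · simp [hg0]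
  · obtain ⟨h1, h2⟩ := hg y hy
    have hy' : 0 < |y| := abs_pos.mpr hy
    refine le_of_mul_le_mul_left ?_ hy'
    rw [← abs_mul, abs_of_pos h1]
    calc y * g y ≤ b * y ^ 2 := h2
      _ = |y| * (b * |y|) := by rw [← sq_abs]; ring

/-- If two vectors are bounded by `c * ξ` and `c * r * ξ`, then one step of the delayed sector
recursion is bounded by `c * ((|A| + r * |B|) D_β ξ)`. -/
theorem abs_sector_step_le {n : ℕ} (A B : Matrix (Fin n) (Fin n) ℝ) (β ξ : Fin n → ℝ)
    (hβ : ∀ i, 0 < β i) (f : Fin n → ℝ → ℝ)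
    (hf : ∀ i y, |f i y| ≤ β i * |y|) (c r : ℝ) (u v : Fin n → ℝ)
    (hu : ∀ i, |u i| ≤ c * ξ i) (hv : ∀ i, |v i| ≤ c * r * ξ i) (i : Fin n) :
    |(A *ᵥ (fun j => f j (u j)) + B *ᵥ (fun j => f j (v j))) i| ≤
      c * (((Matrix.of fun i j => |A i j| + r * |B i j|) * Matrix.diagonal β) *ᵥ ξ) i := by
  simp only [Pi.add_apply, Matrix.mulVec, dotProduct, Matrix.mul_diagonal, Matrix.of_apply]
  rw [← Finset.sum_add_distrib, Finset.mul_sum]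
  refine (Finset.abs_sum_le_sum_abs _ _).trans (Finset.sum_le_sum fun j _ => ?_)
  have hfu : |f j (u j)| ≤ β j * (c * ξ j) :=
    (hf j _).trans (mul_le_mul_of_nonneg_left (hu j) (hβ j).le)
  have hfv : |f j (v j)| ≤ β j * (c * r * ξ j) :=
    (hf j _).trans (mul_le_mul_of_nonneg_left (hv j) (hβ j).le)
  calc |A i j * f j (u j) + B i j * f j (v j)|
      ≤ |A i j| * |f j (u j)| + |B i j| * |f j (v j)| := by
        rw [← abs_mul, ← abs_mul]; exact abs_add_le _ _
    _ ≤ |A i j| * (β j * (c * ξ j)) + |B i j| * (β j * (c * r * ξ j)) := by gcongr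
    _ = c * ((|A i j| + r * |B i j|) * β j * ξ j) := by ring

/-- Theorem 4: absolute exponential stability of the time-varying nonlinear difference system
`x(k+1) = A(k) f(x(k)) + B(k) f(x(k-h))` with sector nonlinearity `f ∈ K(0,β]`, under the
condition `(|A(k)| + λ^{-h} |B(k)|) D_β ξ ≤ λ ξ` for all `k ∈ ℤ₊`; one may take
`L = (min_j ξ_j)⁻¹ · Σ_j ξ_j`. -/
theorem AES_discrete_delay_time_varying (n : ℕ) (hn : 0 < n) (h : ℕ)
    (A B : ℤ → Matrix (Fin n) (Fin n) ℝ)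
    (β : Fin n → ℝ) (hβ : ∀ i, 0 < β i)
    (ξ : Fin n → ℝ) (hξ : ∀ i, 0 < ξ i) (lam : ℝ) (hlam0 : 0 < lam) (hlam1 : lam < 1)
    (hcond : ∀ k : ℤ, 0 ≤ k → ∀ i,
      (((Matrix.of fun i j => |A k i j| + lam ^ (-(h : ℤ)) * |B k i j|) *
          Matrix.diagonal β) *ᵥ ξ) i ≤ lam * ξ i) :
    ∀ f : Fin n → ℝ → ℝ,
      (∀ i, ∀ y : ℝ, y ≠ 0 → 0 < y * f i y ∧ y * f i y ≤ β i * y ^ 2) →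
      (∀ i, f i 0 = 0) →
      ∀ φ : ℤ → Fin n → ℝ, ∀ x : ℤ → Fin n → ℝ,
        (∀ k : ℤ, 0 ≤ k →
          x (k + 1) = A k *ᵥ (fun i => f i (x k i)) + B k *ᵥ (fun i => f i (x (k - h) i))) →
        (∀ k : ℤ, -(h : ℤ) ≤ k → k ≤ 0 → x k = φ k) →
        ∀ k : ℤ, 0 ≤ k →
          ∑ i, |x k i| ≤
            ((Finset.univ.inf' ⟨⟨0, hn⟩, Finset.mem_univ _⟩ ξ)⁻¹ * ∑ j, ξ j) * lam ^ k *
              (Finset.Icc (-(h : ℤ)) 0).sup' (Finset.nonempty_Icc.mpr (by omega))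
                (fun j => ∑ i, |φ j i|) := by
  intro f hf hf0 φ x hx hxφ k hk
  set m := Finset.univ.inf' ⟨⟨0, hn⟩, Finset.mem_univ _⟩ ξ
  set M := (Finset.Icc (-(h : ℤ)) 0).sup' (Finset.nonempty_Icc.mpr (by omega))
    (fun j => ∑ i, |φ j i|)
  have hmpos : 0 < m := (Finset.lt_inf'_iff _).mpr fun i _ => hξ i
  have hmle : ∀ i, m ≤ ξ i := fun i => Finset.inf'_le _ (Finset.mem_univ i)
  have hMle : ∀ j : ℤ, -(h : ℤ) ≤ j → j ≤ 0 → ∑ i, |φ j i| ≤ M := fun j h1 h2 =>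
    Finset.le_sup' (fun j => ∑ i, |φ j i|) (Finset.mem_Icc.mpr ⟨h1, h2⟩)
  have hM0 : 0 ≤ M :=
    (Finset.sum_nonneg fun i _ => abs_nonneg (φ 0 i)).trans (hMle 0 (by omega) le_rfl)
  have hmain : ∀ N : ℕ, ∀ k : ℤ, -(h : ℤ) ≤ k → k ≤ N →
      ∀ i, |x k i| ≤ m⁻¹ * M * lam ^ k * ξ i := by
    intro N
    induction N with
    | zero =>
      intro k hk1 hk2 i
      have hk2' : k ≤ 0 := by simpa using hk2
      have hpow : 1 ≤ lam ^ k := one_le_zpow_of_nonpos₀ hlam0 hlam1.le hk2'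
      have hone : 1 ≤ m⁻¹ * ξ i := by
        rw [← div_eq_inv_mul]; exact (one_le_div hmpos).mpr (hmle i)
      rw [hxφ k hk1 hk2']
      calc |φ k i| ≤ ∑ i, |φ k i| :=
            Finset.single_le_sum (f := fun i => |φ k i|) (fun i _ => abs_nonneg _)
              (Finset.mem_univ i)
        _ ≤ M := hMle k hk1 hk2'
        _ ≤ M * (lam ^ k * (m⁻¹ * ξ i)) :=
            le_mul_of_one_le_right hM0 (one_le_mul_of_one_le_of_one_le hpow hone)
        _ = m⁻¹ * M * lam ^ k * ξ i := by ring
    | succ N ih =>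
      intro k hk1 hk2 i
      rcases le_or_gt k N with hkN | hkN
      · exact ih k hk1 hkN i
      · obtain rfl : k = (N : ℤ) + 1 := by push_cast at hk2; omega
        rw [hx N (by omega)]
        have hv : ∀ i, |x ((N : ℤ) - h) i| ≤
            m⁻¹ * M * lam ^ (N : ℤ) * lam ^ (-(h : ℤ)) * ξ i := by
          intro i
          have := ih ((N : ℤ) - h) (by omega) (by omega) i
          rwa [sub_eq_add_neg, zpow_add₀ hlam0.ne', ← mul_assoc, ← sub_eq_add_neg] at this
        calc _ ≤ _ := abs_sector_step_le (A N) (B N) β ξ hβ f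
              (fun i => abs_le_mul_abs_of_sector (hf i) (hf0 i)) _ _ _ _
              (ih N (by omega) le_rfl) hv i
          _ ≤ m⁻¹ * M * lam ^ (N : ℤ) * (lam * ξ i) :=
              mul_le_mul_of_nonneg_left (hcond N (by omega) i) (by positivity)
          _ = m⁻¹ * M * lam ^ ((N : ℤ) + 1) * ξ i := by
              rw [zpow_add_one₀ hlam0.ne']; ring
  calc ∑ i, |x k i| ≤ ∑ i, m⁻¹ * M * lam ^ k * ξ i :=
        Finset.sum_le_sum fun i _ => hmain k.toNat k (by omega) (by omega) i
    _ = m⁻¹ * (∑ j, ξ j) * lam ^ k * M := by rw [← Finset.mul_sum]; ring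
end
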